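/- Let f : ℝ≥0 × ℝⁿ → ℝⁿ be continuous in (t,x), let C ⊆ ℝⁿ be open, connected, and forward invariant for ẋ = f(t,x), and let ‖·‖ be a norm on ℝⁿ with compatible weak pairing ⟦·,·⟧ satisfying both the curve norm derivative formula and Deimling's inequality. Then for b ∈ ℝ the following are equivalent: (i) ⟦f(t,x) − f(t,y), x − y⟧ ≤ b‖x − y‖² for all x, y ∈ C and t ≥ 0; (ii) D⁺‖φ(t,t₀,x₀) − φ(t,t₀,y₀)‖ ≤ b‖φ(t,t₀,x₀) − φ(t,t₀,y₀)‖ for all x₀, y₀ ∈ C and 0 ≤ t₀ ≤ t for which solutions exist; (iii) ‖φ(t,t₀,x₀) − φ(t,t₀,y₀)‖ ≤ e^{b(t−s)}‖φ(s,t₀,x₀) − φ(s,t₀,y₀)‖ for all x₀, y₀ ∈ C and 0 ≤ t₀ ≤ s ≤ t for which solutions exist. Moreover, if these statements hold then solutions of ẋ = f(t,x) are unique, and if additionally b < 0 and there exists x* ∈ ℝⁿ with f(t,x*) = 0 for all t ≥ 0, then solutions exist uniquely for all time t ≥ 0. -/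

import Mathlib

open Filter Topology MeasureTheory

/-- The upper right Dini derivative `D⁺φ(t) = limsup_{h→0⁺} (φ(t+h)−φ(t))/h`. -/
noncomputable def DiniUpper (φ : ℝ → ℝ) (t : ℝ) : ℝ :=
  Filter.limsup (fun h : ℝ => (φ (t + h) - φ t) / h) (nhdsWithin 0 (Set.Ioi 0))

/-- `ν` is a norm on `ℝⁿ`. -/
structure IsNorm {n : ℕ} (ν : (Fin n → ℝ) → ℝ) : Prop where
  pos : ∀ x, x ≠ 0 → 0 < ν x
  homog : ∀ (a : ℝ) (x : Fin n → ℝ), ν (a • x) = |a| * ν x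
  triangle : ∀ x y, ν (x + y) ≤ ν x + ν y

/-- `P` is a weak pairing on `ℝⁿ`. -/
structure IsWeakPairing {n : ℕ} (P : (Fin n → ℝ) → (Fin n → ℝ) → ℝ) : Prop where
  subadd : ∀ x₁ x₂ y, P (x₁ + x₂) y ≤ P x₁ y + P x₂ y
  cont : ∀ y, Continuous fun x => P x y
  homog_left : ∀ (a : ℝ), 0 ≤ a → ∀ x y, P (a • x) y = a * P x y
  homog_right : ∀ (a : ℝ), 0 ≤ a → ∀ x y, P x (a • y) = a * P x y
  neg_neg : ∀ x y, P (-x) (-y) = P x y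
  posdef : ∀ x, x ≠ 0 → 0 < P x x
  cauchySchwarz : ∀ x y, |P x y| ≤ Real.sqrt (P x x) * Real.sqrt (P y y)

/-- A weak pairing `P` is compatible with the norm `ν`. -/
def Compatible {n : ℕ} (ν : (Fin n → ℝ) → ℝ)
    (P : (Fin n → ℝ) → (Fin n → ℝ) → ℝ) : Prop :=
  ∀ x, P x x = (ν x) ^ 2

/-- Deimling's inequality: `⟦x,y⟧ ≤ ‖y‖ · lim_{h→0⁺}(‖y+hx‖−‖y‖)/h`
(the one-sided limit exists for every norm). -/
def DeimlingIneq {n : ℕ} (ν : (Fin n → ℝ) → ℝ)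
    (P : (Fin n → ℝ) → (Fin n → ℝ) → ℝ) : Prop :=
  ∀ x y L, Filter.Tendsto (fun h : ℝ => (ν (y + h • x) - ν y) / h)
      (nhdsWithin 0 (Set.Ioi 0)) (nhds L) → P x y ≤ ν y * L

/-- The curve norm derivative formula: for any differentiable curve,
`‖x(t)‖ D⁺‖x(t)‖ = ⟦ẋ(t), x(t)⟧` for a.e. `t`. -/
def CurveNormDerivFormula {n : ℕ} (ν : (Fin n → ℝ) → ℝ)
    (P : (Fin n → ℝ) → (Fin n → ℝ) → ℝ) : Prop :=
  ∀ (a b : ℝ) (x x' : ℝ → Fin n → ℝ),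
    (∀ t ∈ Set.Ioo a b, HasDerivAt x (x' t) t) →
    ∀ᵐ t ∂(volume : Measure ℝ), t ∈ Set.Ioo a b →
      ν (x t) * DiniUpper (fun s => ν (x s)) t = P (x' t) (x t)

/-- The operator norm on matrices induced by the norm `ν` on `ℝⁿ`. -/
noncomputable def opNorm {n : ℕ} (ν : (Fin n → ℝ) → ℝ)
    (A : Matrix (Fin n) (Fin n) ℝ) : ℝ :=
  sSup ((fun x => ν (A.mulVec x)) '' {x | ν x = 1})

/-- `m` is the matrix measure of `A` induced by `ν`:
`m = lim_{h→0⁺} (‖I + hA‖ − 1)/h`. -/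
def HasMatrixMeasure {n : ℕ} (ν : (Fin n → ℝ) → ℝ)
    (A : Matrix (Fin n) (Fin n) ℝ) (m : ℝ) : Prop :=
  Filter.Tendsto
    (fun h : ℝ => (opNorm ν ((1 : Matrix (Fin n) (Fin n) ℝ) + h • A) - 1) / h)
    (nhdsWithin 0 (Set.Ioi 0)) (nhds m)

section Peano

variable {E : Type*} [NormedAddCommGroup E] [NormedSpace ℝ E]

/-- The Euler scheme with step `h` for `ẋ = g(t,x)`, `x(t₀) = x₀`. -/
noncomputable def eulerSeq (g : ℝ → E → E) (t₀ : ℝ) (x₀ : E) (h : ℝ) : ℕ → E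
  | 0 => x₀
  | j + 1 => eulerSeq g t₀ x₀ h j + h • g (t₀ + j * h) (eulerSeq g t₀ x₀ h j)

lemma norm_eulerSeq_sub_sub_smul_le {g : ℝ → E → E} {t₀ : ℝ} {x₀ : E} {h ε : ℝ} (hh : 0 ≤ h)
    (v : E) {i j : ℕ} (hij : i ≤ j)
    (H : ∀ m, i ≤ m → m < j → ‖g (t₀ + m * h) (eulerSeq g t₀ x₀ h m) - v‖ ≤ ε) :
    ‖eulerSeq g t₀ x₀ h j - eulerSeq g t₀ x₀ h i - (j * h - i * h) • v‖
      ≤ (j * h - i * h) * ε := by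
  induction j, hij using Nat.le_induction with
  | base => simp
  | succ j hij ih =>
    have h1 := ih fun m hm hmj => H m hm (by omega)
    have h2 := H j hij (by omega)
    have h3 : eulerSeq g t₀ x₀ h (j + 1) - eulerSeq g t₀ x₀ h i
          - (((j + 1 : ℕ) : ℝ) * h - i * h) • v
        = (eulerSeq g t₀ x₀ h j - eulerSeq g t₀ x₀ h i - (j * h - i * h) • v)
          + h • (g (t₀ + j * h) (eulerSeq g t₀ x₀ h j) - v) := by
      rw [eulerSeq]
      push_cast
      module
    rw [h3]
    refine (norm_add_le _ _).trans ?_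
    rw [norm_smul, Real.norm_of_nonneg hh]
    push_cast
    nlinarith [mul_le_mul_of_nonneg_left h2 hh]

lemma norm_eulerSeq_sub_le {g : ℝ → E → E} {t₀ : ℝ} {x₀ : E} {h M : ℝ} (hh : 0 ≤ h)
    (hM : ∀ t x, ‖g t x‖ ≤ M) {i j : ℕ} (hij : i ≤ j) :
    ‖eulerSeq g t₀ x₀ h j - eulerSeq g t₀ x₀ h i‖ ≤ (j * h - i * h) * M := by
  simpa using norm_eulerSeq_sub_sub_smul_le (g := g) (t₀ := t₀) (x₀ := x₀) hh 0 hij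
    (fun m _ _ => by simpa using hM _ _)

lemma floor_div_mul_le_and_lt {h s : ℝ} (hh : 0 < h) (hs : 0 ≤ s) :
    (⌊s / h⌋₊ : ℝ) * h ≤ s ∧ s < (⌊s / h⌋₊ : ℝ) * h + h := by
  constructor
  · rw [← le_div_iff₀ hh]
    exact Nat.floor_le (by positivity)
  · have := Nat.lt_floor_add_one (s / h)
    rw [div_lt_iff₀ hh] at this
    linarith

/-- Peano's existence theorem for a bounded continuous vector field. -/
theorem exists_hasDerivAt_of_continuous_of_bounded [ProperSpace E] {g : ℝ → E → E}
    (hg : Continuous fun p : ℝ × E => g p.1 p.2) {M : ℝ} (hM : ∀ t x, ‖g t x‖ ≤ M)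
    (t₀ : ℝ) (x₀ : E) :
    ∃ X : ℝ → E, (∀ t ≤ t₀, X t = x₀ + (t - t₀) • g t₀ x₀) ∧
      ∀ t, t₀ ≤ t → HasDerivAt X (g t (X t)) t := by
  have hM0 : 0 ≤ M := (norm_nonneg _).trans (hM t₀ x₀)
  let step : ℕ → ℝ := fun k => 1 / ((k : ℝ) + 1)
  have step_pos : ∀ k, 0 < step k := fun k => by positivity
  let U : Ultrafilter ℕ := hyperfilter ℕ
  have hU : (U : Filter ℕ) ≤ atTop := Nat.hyperfilter_le_atTop
  have step_lim : Tendsto step U (𝓝 0) :=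
    (tendsto_one_div_add_atTop_nhds_zero_nat (𝕜 := ℝ)).mono_left hU
  let N : ℕ → ℝ → ℕ := fun k t => ⌊(t - t₀) / step k⌋₊
  let A : ℕ → ℝ → E := fun k t => eulerSeq g t₀ x₀ (step k) (N k t)
  have hN : ∀ k t, t₀ ≤ t → (N k t : ℝ) * step k ≤ t - t₀ ∧
      t - t₀ < (N k t : ℝ) * step k + step k := fun k t ht =>
    floor_div_mul_le_and_lt (step_pos k) (by linarith)
  have N_lim : ∀ t, t₀ ≤ t → Tendsto (fun k => (N k t : ℝ) * step k) U (𝓝 (t - t₀)) := by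
    intro t ht
    refine tendsto_of_tendsto_of_tendsto_of_le_of_le (g := fun k => t - t₀ - step k)
      (h := fun _ => t - t₀) ?_ tendsto_const_nhds (fun k => ?_) (fun k => (hN k t ht).1)
    · simpa using step_lim.const_sub (t - t₀)
    · have := (hN k t ht).2
      simp only
      linarith
  have hNmono : ∀ k, Monotone (N k) := fun k s t hst =>
    Nat.floor_mono (div_le_div_of_nonneg_right (by linarith) (step_pos k).le)
  have hex : ∀ t, ∃ x, t₀ ≤ t → Tendsto (fun k => A k t) U (𝓝 x) := by
    intro t
    by_cases ht : t₀ ≤ t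
    · have hmem : ∀ k, A k t ∈ Metric.closedBall x₀ ((t - t₀) * M) := by
        intro k
        have h1 := norm_eulerSeq_sub_le (g := g) (t₀ := t₀) (x₀ := x₀) (step_pos k).le hM
          (Nat.zero_le (N k t))
        simp only [eulerSeq, Nat.cast_zero, zero_mul, sub_zero] at h1
        rw [mem_closedBall_iff_norm]
        exact h1.trans (mul_le_mul_of_nonneg_right (hN k t ht).1 hM0)
      obtain ⟨x, -, hx⟩ := (isCompact_closedBall x₀ ((t - t₀) * M)).ultrafilter_le_nhds'
        (U.map fun k => A k t) (Ultrafilter.mem_map.2 (Ultrafilter.mem_coe.1 (Filter.univ_mem' hmem)))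
      exact ⟨x, fun _ => hx⟩
    · exact ⟨x₀, fun h => absurd h ht⟩
  choose Y hY using hex
  have hY0 : Y t₀ = x₀ := by
    refine tendsto_nhds_unique (hY t₀ le_rfl) ?_
    have : (fun k => A k t₀) = fun _ => x₀ := by
      funext k
      simp [A, N, eulerSeq]
    rw [this]
    exact tendsto_const_nhds
  have key : ∀ s, t₀ ≤ s → ∀ ε > 0, ∃ δ > 0, ∀ a c, t₀ ≤ a → a ≤ s → s ≤ c → s - δ < a →
      c < s + δ → ‖Y c - Y a - (c - a) • g s (Y s)‖ ≤ (c - a) * ε := by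
    intro s hs ε hε
    obtain ⟨η, hη, hball⟩ := Metric.continuous_iff.1 hg (s, Y s) ε hε
    refine ⟨η / (8 * (M + 1)), by positivity, fun a c ha has hsc hδa hδc => ?_⟩
    set δ := η / (8 * (M + 1)) with hδ
    have hδ0 : 0 < δ := by positivity
    have hδM : δ * M + δ = η / 8 := by rw [hδ]; field_simp
    have hc : t₀ ≤ c := by linarith
    have hlimL : Tendsto (fun k => ‖A k c - A k a
        - ((N k c : ℝ) * step k - N k a * step k) • g s (Y s)‖) U
        (𝓝 ‖Y c - Y a - ((c - t₀) - (a - t₀)) • g s (Y s)‖) :=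
      (((hY c hc).sub (hY a ha)).sub
        (((N_lim c hc).sub (N_lim a ha)).smul_const _)).norm
    have hlimR : Tendsto (fun k => ((N k c : ℝ) * step k - N k a * step k) * ε) U
        (𝓝 (((c - t₀) - (a - t₀)) * ε)) := ((N_lim c hc).sub (N_lim a ha)).mul_const ε
    rw [show c - t₀ - (a - t₀) = c - a by ring] at hlimL hlimR
    refine le_of_tendsto_of_tendsto hlimL hlimR ?_
    filter_upwards [step_lim.eventually (gt_mem_nhds hδ0),
      Metric.tendsto_nhds.1 (hY s hs) (η / 4) (by positivity)] with k hk hks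
    refine norm_eulerSeq_sub_sub_smul_le (step_pos k).le _ (hNmono k (has.trans hsc)) ?_
    intro m hm hmc
    have hstep := step_pos k
    have hm1 : (N k a : ℝ) * step k ≤ m * step k :=
      mul_le_mul_of_nonneg_right (by exact_mod_cast hm) hstep.le
    have hm2 : (m : ℝ) * step k ≤ N k c * step k :=
      mul_le_mul_of_nonneg_right (by exact_mod_cast hmc.le) hstep.le
    obtain ⟨a1, a2⟩ := hN k a ha
    obtain ⟨c1, c2⟩ := hN k c hc
    obtain ⟨s1, s2⟩ := hN k s hs
    have hδη : δ ≤ η / 8 := by nlinarith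
    have htime : |t₀ + m * step k - s| < η := by
      rw [abs_lt]
      constructor <;> linarith
    have hdist : ‖eulerSeq g t₀ x₀ (step k) m - A k s‖ ≤ 3 * δ * M := by
      rcases le_total m (N k s) with hms | hms
      · rw [norm_sub_rev]
        refine (norm_eulerSeq_sub_le hstep.le hM hms).trans ?_
        exact mul_le_mul_of_nonneg_right (by linarith) hM0
      · refine (norm_eulerSeq_sub_le hstep.le hM hms).trans ?_
        exact mul_le_mul_of_nonneg_right (by linarith) hM0
    have hspace : dist (eulerSeq g t₀ x₀ (step k) m) (Y s) < η := by
      rw [← dist_eq_norm] at hdist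
      have := dist_triangle (eulerSeq g t₀ x₀ (step k) m) (A k s) (Y s)
      nlinarith
    have := hball (t₀ + m * step k, eulerSeq g t₀ x₀ (step k) m)
      (by rw [Prod.dist_eq]; exact max_lt htime hspace)
    rw [dist_eq_norm] at this
    exact this.le
  have hright : ∀ t, t₀ ≤ t → HasDerivWithinAt Y (g t (Y t)) (Set.Ici t₀) t := by
    intro t ht
    rw [hasDerivWithinAt_iff_isLittleO, Asymptotics.isLittleO_iff]
    intro ε hε
    obtain ⟨δ, hδ, H⟩ := key t ht ε hε
    filter_upwards [self_mem_nhdsWithin, mem_nhdsWithin_of_mem_nhds (Metric.ball_mem_nhds t hδ)]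
      with s (hs : t₀ ≤ s) hst
    rw [Metric.mem_ball, Real.dist_eq, abs_lt] at hst
    rcases le_total t s with h | h
    · have := H t s ht le_rfl h (by linarith) (by linarith)
      rw [Real.norm_of_nonneg (by linarith), mul_comm ε]
      exact this
    · have := H s t hs h le_rfl (by linarith) (by linarith)
      rw [Real.norm_of_nonpos (by linarith), mul_comm ε, neg_sub]
      rwa [show Y s - Y t - (s - t) • g t (Y t) = -(Y t - Y s - (t - s) • g t (Y t)) by module,
        norm_neg]
  let X : ℝ → E := fun t => if t ≤ t₀ then x₀ + (t - t₀) • g t₀ x₀ else Y t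
  have hX1 : ∀ t ≤ t₀, X t = x₀ + (t - t₀) • g t₀ x₀ := fun t ht => if_pos ht
  have hX2 : ∀ t, t₀ ≤ t → X t = Y t := by
    intro t ht
    rcases ht.eq_or_lt with rfl | ht
    · rw [hX1 _ le_rfl, hY0]
      simp
    · exact if_neg ht.not_ge
  refine ⟨X, hX1, fun t ht => ?_⟩
  have h1 : HasDerivWithinAt X (g t (X t)) (Set.Ici t₀) t := by
    rw [hX2 t ht]
    exact (hright t ht).congr (fun s hs => hX2 s hs) (hX2 t ht)
  rcases ht.eq_or_lt with rfl | ht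
  · have hx : X t₀ = x₀ := by rw [hX2 _ le_rfl, hY0]
    have h2 : HasDerivWithinAt X (g t₀ (X t₀)) (Set.Iic t₀) t₀ := by
      have h3 : HasDerivAt (fun t : ℝ => x₀ + (t - t₀) • g t₀ x₀) (g t₀ x₀) t₀ := by
        simpa using (((hasDerivAt_id t₀).sub_const t₀).smul_const (g t₀ x₀)).const_add x₀
      rw [hx]
      exact h3.hasDerivWithinAt.congr (fun s hs => hX1 s hs) (hX1 _ le_rfl)
    have := h2.union h1
    rwa [Set.Iic_union_Ici, hasDerivWithinAt_univ] at this
  · exact h1.hasDerivAt (Ici_mem_nhds ht)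

/-- Radial truncation of a vector to norm at most `M`. -/
noncomputable def radialClip (M : ℝ) (v : E) : E := (M / max M ‖v‖) • v

lemma norm_radialClip_le {M : ℝ} (hM : 0 < M) (v : E) : ‖radialClip M v‖ ≤ M := by
  have h : 0 < max M ‖v‖ := lt_max_of_lt_left hM
  rw [radialClip, norm_smul, Real.norm_of_nonneg (by positivity), div_mul_eq_mul_div,
    div_le_iff₀ h]
  exact mul_le_mul_of_nonneg_left (le_max_right _ _) hM.le

lemma radialClip_eq_self {M : ℝ} (hM : 0 < M) {v : E} (hv : ‖v‖ ≤ M) : radialClip M v = v := by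
  rw [radialClip, max_eq_left hv, div_self hM.ne', one_smul]

lemma continuous_radialClip {M : ℝ} (hM : 0 < M) : Continuous (radialClip M : E → E) := by
  unfold radialClip
  exact (continuous_const.div (continuous_const.max continuous_norm)
    fun v => (lt_max_of_lt_left hM).ne').smul continuous_id

lemma exists_hasDerivAt_radialClip [ProperSpace E] {f : ℝ → E → E}
    (hf : Continuous fun p : ℝ × E => f p.1 p.2) {M : ℝ} (hM : 0 < M) (t₀ : ℝ) (x₀ : E) :
    ∃ X : ℝ → E, (∀ t ≤ t₀, X t = x₀ + (t - t₀) • radialClip M (f t₀ x₀)) ∧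
      ∀ t, t₀ ≤ t → HasDerivAt X (radialClip M (f t (X t))) t :=
  exists_hasDerivAt_of_continuous_of_bounded (g := fun t x => radialClip M (f t x))
    ((continuous_radialClip hM).comp hf) (fun _ _ => norm_radialClip_le hM _) t₀ x₀

/-- Peano's local existence theorem. -/
theorem exists_hasDerivAt_of_continuous [ProperSpace E] {f : ℝ → E → E}
    (hf : Continuous fun p : ℝ × E => f p.1 p.2) (t₀ : ℝ) (x₀ : E) :
    ∃ X : ℝ → E, X t₀ = x₀ ∧
      ∃ ε > 0, ∀ t ∈ Set.Icc t₀ (t₀ + ε), HasDerivAt X (f t (X t)) t := by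
  set M := ‖f t₀ x₀‖ + 1 with hMdef
  have hM : 0 < M := by positivity
  obtain ⟨X, hX1, hX2⟩ := exists_hasDerivAt_radialClip hf hM t₀ x₀
  have hX0 : X t₀ = x₀ := by simpa using hX1 t₀ le_rfl
  have hcont : ContinuousAt (fun t => ‖f t (X t)‖) t₀ :=
    (hf.continuousAt.comp (continuousAt_id.prodMk (hX2 t₀ le_rfl).continuousAt)).norm
  have hev : ∀ᶠ t in 𝓝 t₀, ‖f t (X t)‖ < M :=
    hcont.eventually (gt_mem_nhds (by simp only [hX0, hMdef]; linarith))
  obtain ⟨δ, hδ, hball⟩ := Metric.eventually_nhds_iff.1 hev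
  refine ⟨X, hX0, δ / 2, by positivity, fun t ht => ?_⟩
  have h1 := hball (y := t) (by
    rw [Real.dist_eq, abs_of_nonneg (by linarith [ht.1])]
    linarith [ht.2])
  simpa only [radialClip_eq_self hM h1.le] using hX2 t ht.1

/-- An a priori bound on solutions gives existence on a prescribed interval. -/
theorem exists_hasDerivAt_Icc_of_bound [ProperSpace E] {f : ℝ → E → E}
    (hf : Continuous fun p : ℝ × E => f p.1 p.2) {t₀ T R : ℝ} {x₀ : E}
    (hT : t₀ ≤ T)
    (hR : ∀ (X : ℝ → E), ∀ τ ∈ Set.Icc t₀ T, X t₀ = x₀ →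
      (∀ t ∈ Set.Icc t₀ τ, HasDerivAt X (f t (X t)) t) → ‖X τ‖ ≤ R) :
    ∃ X : ℝ → E, (∀ t ≤ t₀, X t = x₀ + (t - t₀) • f t₀ x₀) ∧
      ∀ t ∈ Set.Icc t₀ T, HasDerivAt X (f t (X t)) t := by
  obtain ⟨M₀, hM₀⟩ := (isCompact_Icc.prod (isCompact_closedBall (0 : E)
    (max R ‖x₀‖))).exists_bound_of_continuousOn
    (s := Set.Icc t₀ T ×ˢ Metric.closedBall (0 : E) (max R ‖x₀‖)) hf.continuousOn
  have hM₀' : ∀ t ∈ Set.Icc t₀ T, ∀ x, ‖x‖ ≤ max R ‖x₀‖ → ‖f t x‖ ≤ M₀ := fun t ht x hx =>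
    hM₀ (t, x) ⟨ht, by simpa using hx⟩
  have h0 : ‖f t₀ x₀‖ ≤ M₀ := hM₀' t₀ ⟨le_rfl, hT⟩ x₀ (le_max_right _ _)
  set M := M₀ + 1 with hMdef
  have hM : 0 < M := by linarith [norm_nonneg (f t₀ x₀)]
  obtain ⟨X, hX1, hX2⟩ := exists_hasDerivAt_radialClip hf hM t₀ x₀
  have hX0 : X t₀ = x₀ := by simpa using hX1 t₀ le_rfl
  have hclip : ∀ t, t₀ ≤ t → ‖f t (X t)‖ ≤ M → HasDerivAt X (f t (X t)) t := fun t ht h => by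
    simpa only [radialClip_eq_self hM h] using hX2 t ht
  have hcont : ∀ t, t₀ ≤ t → ContinuousAt (fun t => ‖f t (X t)‖) t := fun t ht =>
    (hf.continuousAt.comp (continuousAt_id.prodMk (hX2 t ht).continuousAt)).norm
  have hlt : ∀ t ∈ Set.Icc t₀ T, ‖f t (X t)‖ < M := by
    by_contra! hne
    obtain ⟨t₁, ht₁, hMt₁⟩ := hne
    have hcomp : IsCompact (Set.Icc t₀ T ∩ (fun t => ‖f t (X t)‖) ⁻¹' Set.Ici M) :=
      isCompact_Icc.of_isClosed_subset (ContinuousOn.preimage_isClosed_of_isClosed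
        (fun t ht => (hcont t ht.1).continuousWithinAt) isClosed_Icc isClosed_Ici)
        Set.inter_subset_left
    obtain ⟨τ, ⟨hτ, hMτ⟩, hleast⟩ := hcomp.exists_isLeast ⟨t₁, ht₁, hMt₁⟩
    have hbefore : ∀ t ∈ Set.Ico t₀ τ, ‖f t (X t)‖ < M := by
      intro t ht
      by_contra! h
      exact absurd (hleast ⟨⟨ht.1, ht.2.le.trans hτ.2⟩, h⟩) ht.2.not_ge
    have hτle : ‖f τ (X τ)‖ ≤ M := by
      rcases hτ.1.eq_or_lt with rfl | hlt
      · rw [hX0]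
        linarith
      · refine le_of_tendsto ((hcont τ hτ.1).tendsto.mono_left
          (nhdsWithin_le_nhds (s := Set.Iio τ))) ?_
        filter_upwards [Ioo_mem_nhdsLT hlt] with t ht
        exact (hbefore t ⟨ht.1.le, ht.2⟩).le
    have hXτ : ‖X τ‖ ≤ R := hR X τ hτ hX0 fun t ht => by
      rcases ht.2.eq_or_lt with rfl | h
      · exact hclip _ ht.1 hτle
      · exact hclip t ht.1 (hbefore t ⟨ht.1, h⟩).le
    have h1 := hM₀' τ hτ (X τ) (hXτ.trans (le_max_left _ _))
    have h2 : M ≤ ‖f τ (X τ)‖ := hMτ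
    linarith
  refine ⟨X, fun t ht => ?_, fun t ht => hclip t ht.1 (hlt t ht).le⟩
  rw [hX1 t ht, radialClip_eq_self hM (by linarith)]

/-- A priori bounds on bounded intervals together with uniqueness give a global solution. -/
theorem exists_hasDerivAt_Ici_of_bound [ProperSpace E] {f : ℝ → E → E}
    (hf : Continuous fun p : ℝ × E => f p.1 p.2) {t₀ : ℝ} {x₀ : E}
    (hR : ∀ T, t₀ ≤ T → ∃ R, ∀ (X : ℝ → E), ∀ τ ∈ Set.Icc t₀ T, X t₀ = x₀ →
      (∀ t ∈ Set.Icc t₀ τ, HasDerivAt X (f t (X t)) t) → ‖X τ‖ ≤ R)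
    (huniq : ∀ (X Y : ℝ → E) (τ : ℝ), t₀ ≤ τ → X t₀ = x₀ → Y t₀ = x₀ →
      (∀ t ∈ Set.Icc t₀ τ, HasDerivAt X (f t (X t)) t) →
      (∀ t ∈ Set.Icc t₀ τ, HasDerivAt Y (f t (Y t)) t) → X τ = Y τ) :
    ∃ X : ℝ → E, X t₀ = x₀ ∧ ∀ t, t₀ ≤ t → HasDerivAt X (f t (X t)) t := by
  have hex : ∀ N : ℕ, ∃ X : ℝ → E, (∀ t ≤ t₀, X t = x₀ + (t - t₀) • f t₀ x₀) ∧
      ∀ t ∈ Set.Icc t₀ (t₀ + N), HasDerivAt X (f t (X t)) t := fun N => by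
    have hN : t₀ ≤ t₀ + N := by simp
    obtain ⟨R, hR⟩ := hR _ hN
    exact exists_hasDerivAt_Icc_of_bound hf hN hR
  choose X hX1 hX2 using hex
  have hX0 : ∀ N, X N t₀ = x₀ := fun N => by simpa using hX1 N t₀ le_rfl
  have hagree : ∀ N N' : ℕ, ∀ t, t ≤ t₀ + N → t ≤ t₀ + N' → X N t = X N' t := by
    intro N N' t hN hN'
    rcases le_total t t₀ with h | h
    · rw [hX1 N t h, hX1 N' t h]
    · exact huniq _ _ t h (hX0 N) (hX0 N') (fun s hs => hX2 N s ⟨hs.1, hs.2.trans hN⟩)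
        (fun s hs => hX2 N' s ⟨hs.1, hs.2.trans hN'⟩)
  have hceil : ∀ t, t ≤ t₀ + (⌈t - t₀⌉₊ : ℝ) := fun t => by linarith [Nat.le_ceil (t - t₀)]
  refine ⟨fun t => X ⌈t - t₀⌉₊ t, hX0 _, fun t ht => ?_⟩
  have hN : t < t₀ + ((⌈t - t₀⌉₊ + 1 : ℕ) : ℝ) := by
    push_cast
    linarith [hceil t]
  have hev : (fun s => X ⌈s - t₀⌉₊ s) =ᶠ[𝓝 t] X (⌈t - t₀⌉₊ + 1) := by
    filter_upwards [Iio_mem_nhds hN] with s hs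
    exact hagree _ _ s (hceil s) (le_of_lt hs)
  have := (hX2 (⌈t - t₀⌉₊ + 1) t ⟨ht, hN.le⟩).congr_of_eventuallyEq hev
  rwa [← hev.eq_of_nhds] at this

end Peano

/-- The one-sided directional derivative of `ν` at `z` in direction `v`. -/
noncomputable def dirDeriv {n : ℕ} (ν : (Fin n → ℝ) → ℝ) (z v : Fin n → ℝ) : ℝ :=
  derivWithin (fun h : ℝ => ν (z + h • v)) (Set.Ioi 0) 0

namespace IsNorm

variable {n : ℕ} {ν : (Fin n → ℝ) → ℝ}

lemma map_zero (hν : IsNorm ν) : ν 0 = 0 := by simpa using hν.homog 0 0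

lemma nonneg (hν : IsNorm ν) (x : Fin n → ℝ) : 0 ≤ ν x := by
  rcases eq_or_ne x 0 with rfl | hx
  · exact hν.map_zero.ge
  · exact (hν.pos x hx).le

lemma eq_zero_of_le (hν : IsNorm ν) {x : Fin n → ℝ} (h : ν x ≤ 0) : x = 0 := by
  by_contra hx
  exact (hν.pos x hx).not_ge h

lemma map_neg (hν : IsNorm ν) (x : Fin n → ℝ) : ν (-x) = ν x := by
  simpa using hν.homog (-1) x

lemma sub_le (hν : IsNorm ν) (x y : Fin n → ℝ) : ν x - ν y ≤ ν (x - y) := by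
  have := hν.triangle (x - y) y
  rw [sub_add_cancel] at this
  linarith

lemma abs_sub_le (hν : IsNorm ν) (x y : Fin n → ℝ) : |ν x - ν y| ≤ ν (x - y) := by
  have h := hν.sub_le y x
  rw [← neg_sub x y, hν.map_neg] at h
  exact abs_le.2 ⟨by linarith, hν.sub_le x y⟩

lemma exists_le_mul_norm (hν : IsNorm ν) : ∃ K, 0 ≤ K ∧ ∀ x, ν x ≤ K * ‖x‖ := by
  have hsum : ∀ (s : Finset (Fin n)) (g : Fin n → Fin n → ℝ),
      ν (∑ i ∈ s, g i) ≤ ∑ i ∈ s, ν (g i) := fun s g =>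
    Finset.le_sum_of_subadditive ν hν.map_zero.le hν.triangle s g
  refine ⟨∑ i, ν (Pi.single i 1), Finset.sum_nonneg fun i _ => hν.nonneg _, fun x => ?_⟩
  calc ν x = ν (∑ i, x i • Pi.single i (1 : ℝ)) := by rw [← pi_eq_sum_univ' x]
    _ ≤ ∑ i, ν (x i • Pi.single i (1 : ℝ)) := hsum _ _
    _ ≤ ∑ i, ν (Pi.single i 1) * ‖x‖ := Finset.sum_le_sum fun i _ => by
        rw [hν.homog, mul_comm]
        exact mul_le_mul_of_nonneg_left (norm_le_pi_norm x i) (hν.nonneg _)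
    _ = _ := (Finset.sum_mul ..).symm

lemma continuous (hν : IsNorm ν) : Continuous ν := by
  obtain ⟨K, hK, h⟩ := hν.exists_le_mul_norm
  refine (LipschitzWith.of_dist_le_mul (K := ⟨K, hK⟩) fun x y => ?_).continuous
  rw [Real.dist_eq, dist_eq_norm]
  exact (hν.abs_sub_le x y).trans (h _)

lemma exists_norm_le_mul (hν : IsNorm ν) : ∃ c, 0 ≤ c ∧ ∀ x, ‖x‖ ≤ c * ν x := by
  rcases (Metric.sphere (0 : Fin n → ℝ) 1).eq_empty_or_nonempty with he | hne
  · refine ⟨0, le_rfl, fun x => ?_⟩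
    by_contra! hx
    have hx0 : ‖x‖ ≠ 0 := by linarith
    have : ‖x‖⁻¹ • x ∈ Metric.sphere (0 : Fin n → ℝ) 1 := by
      simp [norm_smul, hx0]
    simp [he] at this
  · obtain ⟨e, he, hmin⟩ := (isCompact_sphere (0 : Fin n → ℝ) 1).exists_isMinOn hne
      hν.continuous.continuousOn
    have hepos : 0 < ν e := hν.pos e (by rintro rfl; simp at he)
    refine ⟨(ν e)⁻¹, by positivity, fun x => ?_⟩
    rcases eq_or_ne x 0 with rfl | hx
    · simp [hν.map_zero]
    have hx0 : 0 < ‖x‖ := norm_pos_iff.2 hx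
    have hmem : ‖x‖⁻¹ • x ∈ Metric.sphere (0 : Fin n → ℝ) 1 := by
      simp [norm_smul, hx0.ne']
    have h : ν e ≤ ν (‖x‖⁻¹ • x) := hmin hmem
    rw [hν.homog, abs_of_pos (by positivity), inv_mul_eq_div, le_div_iff₀ hx0] at h
    rw [inv_mul_eq_div, le_div_iff₀ hepos]
    linarith

lemma convexOn_line (hν : IsNorm ν) (z v : Fin n → ℝ) :
    ConvexOn ℝ Set.univ fun h : ℝ => ν (z + h • v) := by
  refine ⟨convex_univ, fun p _ q _ a c ha hc hac => ?_⟩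
  have h : z + (a • p + c • q) • v = a • (z + p • v) + c • (z + q • v) := by
    obtain rfl : c = 1 - a := by linarith
    simp only [smul_eq_mul]
    module
  simp only [h]
  refine (hν.triangle _ _).trans_eq ?_
  rw [hν.homog, hν.homog, abs_of_nonneg ha, abs_of_nonneg hc, smul_eq_mul, smul_eq_mul]

lemma tendsto_dirDeriv (hν : IsNorm ν) (z v : Fin n → ℝ) :
    Tendsto (fun h : ℝ => (ν (z + h • v) - ν z) / h) (𝓝[>] 0) (𝓝 (dirDeriv ν z v)) := by
  have h := (hν.convexOn_line z v).hasDerivWithinAt_rightDeriv_of_mem_interior (x := 0) (by simp)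
  rw [hasDerivWithinAt_iff_tendsto_slope' Set.self_notMem_Ioi] at h
  refine h.congr fun r => ?_
  simp [slope_def_field]

lemma dirDeriv_le_shift (hν : IsNorm ν) (z v : Fin n → ℝ) {s : ℝ} (hs : 0 < s) :
    dirDeriv ν z v ≤ dirDeriv ν (z + s • v) v := by
  have hconv := hν.convexOn_line z v
  have hmono := hconv.monotoneOn_rightDeriv (a := 0) (b := s) (by simp) (by simp) hs.le
  refine hmono.trans (le_of_eq ?_)
  have h1 := hconv.hasDerivWithinAt_rightDeriv_of_mem_interior (x := s) (by simp)
  rw [hasDerivWithinAt_iff_tendsto_slope' Set.self_notMem_Ioi] at h1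
  have hadd : Tendsto (fun h : ℝ => s + h) (𝓝[>] 0) (𝓝[>] s) := by
    refine tendsto_nhdsWithin_of_tendsto_nhds_of_eventually_within _ ?_ ?_
    · simpa using ((continuous_const.add continuous_id).tendsto (0 : ℝ)).mono_left
        (nhdsWithin_le_nhds (s := Set.Ioi (0 : ℝ))) (f := fun h : ℝ => s + h)
    · filter_upwards [self_mem_nhdsWithin] with h (hh : 0 < h)
      simpa using hh
  refine tendsto_nhds_unique ((h1.comp hadd).congr fun h => ?_) (hν.tendsto_dirDeriv _ v)
  simp [slope_def_field, add_smul, add_assoc]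

lemma dirDeriv_add_le (hν : IsNorm ν) (z v w : Fin n → ℝ) :
    dirDeriv ν z (v + w) ≤ dirDeriv ν z v + ν w := by
  refine le_of_tendsto_of_tendsto (hν.tendsto_dirDeriv z (v + w))
    ((hν.tendsto_dirDeriv z v).add_const (ν w)) ?_
  filter_upwards [self_mem_nhdsWithin] with h (hh : 0 < h)
  have h1 := hν.triangle (z + h • v) (h • w)
  rw [hν.homog, abs_of_pos hh, add_assoc, ← smul_add] at h1
  rw [div_add' _ _ _ hh.ne']
  gcongr
  linarith

lemma dirDeriv_zero_right (z : Fin n → ℝ) : dirDeriv ν z 0 = 0 := by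
  simp [dirDeriv]

lemma tendsto_of_hasDerivAt (hν : IsNorm ν) {Z : ℝ → Fin n → ℝ} {v : Fin n → ℝ} {t : ℝ}
    (hZ : HasDerivAt Z v t) :
    Tendsto (fun h : ℝ => (ν (Z (t + h)) - ν (Z t)) / h) (𝓝[>] 0)
      (𝓝 (dirDeriv ν (Z t) v)) := by
  have hslope : Tendsto (fun h : ℝ => ν (h⁻¹ • (Z (t + h) - Z t) - v)) (𝓝[>] 0) (𝓝 0) := by
    have h1 : Tendsto (fun h : ℝ => h⁻¹ • (Z (t + h) - Z t)) (𝓝[>] 0) (𝓝 v) :=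
      (hasDerivAt_iff_tendsto_slope_zero.1 hZ).mono_left
        (nhdsWithin_mono (0 : ℝ) fun h (hh : 0 < h) => hh.ne')
    have h2 := (hν.continuous.tendsto _).comp (h1.sub_const v)
    rwa [sub_self, hν.map_zero] at h2
  have hdiff : Tendsto (fun h : ℝ => (ν (Z (t + h)) - ν (Z t)) / h
      - (ν (Z t + h • v) - ν (Z t)) / h) (𝓝[>] 0) (𝓝 0) := by
    refine squeeze_zero_norm' ?_ hslope
    filter_upwards [self_mem_nhdsWithin] with h (hh : 0 < h)
    have h1 : Z (t + h) - (Z t + h • v) = h • (h⁻¹ • (Z (t + h) - Z t) - v) := by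
      rw [smul_sub, smul_smul, mul_inv_cancel₀ hh.ne', one_smul]
      abel
    have h2 := hν.abs_sub_le (Z (t + h)) (Z t + h • v)
    rw [h1, hν.homog, abs_of_pos hh] at h2
    rw [← sub_div, sub_sub_sub_cancel_right, Real.norm_eq_abs, abs_div, abs_of_pos hh,
      div_le_iff₀ hh, mul_comm]
    exact h2
  simpa using hdiff.add (hν.tendsto_dirDeriv (Z t) v)

lemma diniUpper_eq (hν : IsNorm ν) {Z : ℝ → Fin n → ℝ} {v : Fin n → ℝ} {t : ℝ}
    (hZ : HasDerivAt Z v t) : DiniUpper (fun s => ν (Z s)) t = dirDeriv ν (Z t) v :=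
  (hν.tendsto_of_hasDerivAt hZ).limsup_eq

lemma le_gronwallBound (hν : IsNorm ν) {Z Z' : ℝ → Fin n → ℝ} {b ε s T : ℝ}
    (hZ : ∀ t ∈ Set.Icc s T, HasDerivAt Z (Z' t) t)
    (hb : ∀ t ∈ Set.Icc s T, dirDeriv ν (Z t) (Z' t) ≤ b * ν (Z t) + ε) :
    ∀ t ∈ Set.Icc s T, ν (Z t) ≤ gronwallBound (ν (Z s)) b ε (t - s) := by
  refine le_gronwallBound_of_liminf_deriv_right_le (f := fun t => ν (Z t))
    (f' := fun t => dirDeriv ν (Z t) (Z' t))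
    (fun t ht => (hν.continuous.continuousAt.comp (hZ t ht).continuousAt).continuousWithinAt)
    (fun t ht r hr => ?_) le_rfl (fun t ht => hb t (Set.Ico_subset_Icc_self ht))
  have hev := (hν.tendsto_of_hasDerivAt (hZ t (Set.Ico_subset_Icc_self ht))).eventually
    (gt_mem_nhds hr)
  have hsub : Tendsto (fun z : ℝ => z - t) (𝓝[>] t) (𝓝[>] 0) := by
    refine tendsto_nhdsWithin_of_tendsto_nhds_of_eventually_within _ ?_ ?_
    · simpa using ((continuous_id.sub continuous_const).tendsto t).mono_left
        (nhdsWithin_le_nhds (s := Set.Ioi t)) (f := fun z : ℝ => z - t)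
    · filter_upwards [self_mem_nhdsWithin] with z (hz : t < z)
      simpa using hz
  refine Eventually.frequently ?_
  filter_upwards [hsub.eventually hev] with z hz
  rwa [add_sub_cancel, div_eq_inv_mul] at hz

end IsNorm

lemma frequently_nhdsGT_of_ae {Q : ℝ → Prop} (hQ : ∀ᵐ s ∂(volume : Measure ℝ), Q s) (a : ℝ) :
    ∃ᶠ s in 𝓝[>] a, Q s := by
  rw [frequently_iff]
  intro S hS
  obtain ⟨c, hc, hsub⟩ := (mem_nhdsGT_iff_exists_Ioo_subset).1 hS
  obtain ⟨s, hsQ, hs⟩ := (Measure.dense_of_ae hQ).exists_mem_open isOpen_Ioo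
    (Set.nonempty_Ioo.2 hc)
  exact ⟨s, hsub hs, hsQ⟩

lemma IsWeakPairing.le_mul {n : ℕ} {ν : (Fin n → ℝ) → ℝ} {P : (Fin n → ℝ) → (Fin n → ℝ) → ℝ}
    (hP : IsWeakPairing P) (hν : IsNorm ν) (hcomp : Compatible ν P) (x y : Fin n → ℝ) :
    P x y ≤ ν x * ν y := by
  have h := (le_abs_self _).trans (hP.cauchySchwarz x y)
  rwa [hcomp, hcomp, Real.sqrt_sq (hν.nonneg x), Real.sqrt_sq (hν.nonneg y)] at h

/-- A one-sided Lipschitz bound in terms of a weak pairing satisfying the curve norm derivative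
formula implies the corresponding bound on the directional derivative of the norm. -/
theorem dirDeriv_le_of_pairing_le {n : ℕ} {g : (Fin n → ℝ) → Fin n → ℝ} (hg : Continuous g)
    {C : Set (Fin n → ℝ)} (hC : IsOpen C) {ν : (Fin n → ℝ) → ℝ}
    {P : (Fin n → ℝ) → (Fin n → ℝ) → ℝ} {b : ℝ} (hν : IsNorm ν) (hP : IsWeakPairing P)
    (hcomp : Compatible ν P) (hCNDF : CurveNormDerivFormula ν P)
    (h : ∀ x ∈ C, ∀ y ∈ C, P (g x - g y) (x - y) ≤ b * ν (x - y) ^ 2)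
    {x y : Fin n → ℝ} (hx : x ∈ C) (hy : y ∈ C) :
    dirDeriv ν (x - y) (g x - g y) ≤ b * ν (x - y) := by
  rcases eq_or_ne x y with rfl | hxy
  · simp [IsNorm.dirDeriv_zero_right, hν.map_zero]
  set v := g x - g y with hv
  set z := x - y with hz
  have hZ : ∀ s : ℝ, HasDerivAt (fun s : ℝ => z + s • v) v s := fun s => by
    simpa using ((hasDerivAt_id s).smul_const v).const_add z
  have hfreq := frequently_nhdsGT_of_ae (hCNDF 0 1 (fun s => z + s • v) (fun _ => v)
    fun s _ => hZ s) 0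
  have hXc : Continuous fun s : ℝ => x + s • g x := by fun_prop
  have hYc : Continuous fun s : ℝ => y + s • g y := by fun_prop
  let e : ℝ → Fin n → ℝ := fun s => v - (g (x + s • g x) - g (y + s • g y))
  have hec : Continuous e :=
    continuous_const.sub ((hg.comp hXc).sub (hg.comp hYc))
  have hZc : Continuous fun s : ℝ => z + s • v := by fun_prop
  have hlim : Tendsto (fun s => b * ν (z + s • v) + ν (e s)) (𝓝[>] 0) (𝓝 (b * ν z)) := by
    have h1 := ((continuous_const.mul (hν.continuous.comp hZc)).add
      (hν.continuous.comp hec)).tendsto (0 : ℝ) (f := fun s => b * ν (z + s • v) + ν (e s))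
    simp only [e, zero_smul, add_zero, ← hv, sub_self, hν.map_zero] at h1
    exact h1.mono_left nhdsWithin_le_nhds
  have hXC : ∀ᶠ s : ℝ in 𝓝[>] 0, x + s • g x ∈ C :=
    (hXc.tendsto 0).mono_left nhdsWithin_le_nhds (hC.mem_nhds (by simpa using hx))
  have hYC : ∀ᶠ s : ℝ in 𝓝[>] 0, y + s • g y ∈ C :=
    (hYc.tendsto 0).mono_left nhdsWithin_le_nhds (hC.mem_nhds (by simpa using hy))
  have hpos : ∀ᶠ s : ℝ in 𝓝[>] 0, 0 < ν (z + s • v) :=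
    ((hν.continuous.comp hZc).tendsto 0).mono_left nhdsWithin_le_nhds
      (Ioi_mem_nhds (by simpa using hν.pos z (sub_ne_zero.2 hxy)))
  refine ge_of_tendsto_of_frequently hlim ((hfreq.and_eventually
    (hXC.and (hYC.and (hpos.and (Ioo_mem_nhdsGT one_pos))))).mono ?_)
  rintro s ⟨hs, hsX, hsY, hsp, hs01⟩
  have h1 := hs hs01
  rw [hν.diniUpper_eq (hZ s)] at h1
  have hsum : (g (x + s • g x) - g (y + s • g y)) + e s = v := by simp [e]
  have hsub : (x + s • g x) - (y + s • g y) = z + s • v := by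
    rw [hz, hv]
    module
  have h2 := hP.subadd (g (x + s • g x) - g (y + s • g y)) (e s) (z + s • v)
  have h3 := h _ hsX _ hsY
  rw [hsub] at h3
  have h4 := hP.le_mul hν hcomp (e s) (z + s • v)
  rw [hsum] at h2
  refine (hν.dirDeriv_le_shift z v hs01.1).trans ?_
  refine le_of_mul_le_mul_left ?_ hsp
  nlinarith

/-- Contraction of trajectories implies the bound on the directional derivative of the norm. -/
theorem dirDeriv_le_of_contraction {n : ℕ} {f : ℝ → (Fin n → ℝ) → Fin n → ℝ}
    {C : Set (Fin n → ℝ)} {ν : (Fin n → ℝ) → ℝ} {b : ℝ}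
    (hf : Continuous fun p : ℝ × (Fin n → ℝ) => f p.1 p.2) (hν : IsNorm ν)
    (h : ∀ (X Y : ℝ → Fin n → ℝ) (t₀ T : ℝ), 0 ≤ t₀ → t₀ ≤ T →
        (∀ t ∈ Set.Icc t₀ T, HasDerivAt X (f t (X t)) t) →
        (∀ t ∈ Set.Icc t₀ T, HasDerivAt Y (f t (Y t)) t) →
        X t₀ ∈ C → Y t₀ ∈ C →
        ∀ s ∈ Set.Icc t₀ T, ∀ t ∈ Set.Icc s T,
          ν (X t - Y t) ≤ Real.exp (b * (t - s)) * ν (X s - Y s))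
    {t : ℝ} (ht : 0 ≤ t) {x y : Fin n → ℝ} (hx : x ∈ C) (hy : y ∈ C) :
    dirDeriv ν (x - y) (f t x - f t y) ≤ b * ν (x - y) := by
  obtain ⟨X, rfl, ε, hε, hX⟩ := exists_hasDerivAt_of_continuous hf t x
  obtain ⟨Y, rfl, η, hη, hY⟩ := exists_hasDerivAt_of_continuous hf t y
  have hZ : HasDerivAt (fun s => X s - Y s) (f t (X t) - f t (Y t)) t :=
    (hX t ⟨le_rfl, by linarith⟩).sub (hY t ⟨le_rfl, by linarith⟩)
  have hexp : HasDerivAt (fun s => Real.exp (b * s) * ν (X t - Y t)) (b * ν (X t - Y t)) 0 := by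
    have := (((hasDerivAt_id (0 : ℝ)).const_mul b).exp).mul_const (ν (X t - Y t))
    simpa using this
  have hexp' : Tendsto (fun s : ℝ => (Real.exp (b * s) * ν (X t - Y t) - ν (X t - Y t)) / s)
      (𝓝[>] 0) (𝓝 (b * ν (X t - Y t))) := by
    have h1 := hexp.hasDerivWithinAt (s := Set.Ioi 0)
    rw [hasDerivWithinAt_iff_tendsto_slope' Set.self_notMem_Ioi] at h1
    refine h1.congr fun s => ?_
    simp [slope_def_field]
  refine le_of_tendsto_of_tendsto (hν.tendsto_of_hasDerivAt hZ) hexp' ?_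
  filter_upwards [Ioo_mem_nhdsGT (lt_min hε hη)] with s hs
  have hs1 := hs.2.le.trans (min_le_left _ _)
  have hs2 := hs.2.le.trans (min_le_right _ _)
  have hts : t ≤ t + s := by linarith [hs.1]
  have h1 := h X Y t (t + s) ht hts (fun r hr => hX r ⟨hr.1, hr.2.trans (by linarith)⟩)
    (fun r hr => hY r ⟨hr.1, hr.2.trans (by linarith)⟩) hx hy t ⟨le_rfl, hts⟩ (t + s)
    ⟨hts, le_rfl⟩
  rw [add_sub_cancel_left] at h1
  have := hs.1
  gcongr

/-- A solution starting in a forward invariant set on which `f` satisfies a one-sided Lipschitz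
bound stays bounded on bounded time intervals. -/
theorem exists_norm_le_of_dirDeriv_le {n : ℕ} {f : ℝ → (Fin n → ℝ) → Fin n → ℝ}
    {C : Set (Fin n → ℝ)} {ν : (Fin n → ℝ) → ℝ} {b : ℝ}
    (hf : Continuous fun p : ℝ × (Fin n → ℝ) => f p.1 p.2) (hν : IsNorm ν)
    (hCinv : ∀ (x : ℝ → Fin n → ℝ) (t₀ T : ℝ), 0 ≤ t₀ → t₀ ≤ T →
      (∀ t ∈ Set.Icc t₀ T, HasDerivAt x (f t (x t)) t) → x t₀ ∈ C →
      ∀ t ∈ Set.Icc t₀ T, x t ∈ C)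
    (h : ∀ t, 0 ≤ t → ∀ x ∈ C, ∀ y ∈ C,
      dirDeriv ν (x - y) (f t x - f t y) ≤ b * ν (x - y))
    {t₀ : ℝ} (ht₀ : 0 ≤ t₀) {x₀ : Fin n → ℝ} (hx₀ : x₀ ∈ C) (T : ℝ) :
    ∃ R, ∀ (X : ℝ → Fin n → ℝ), ∀ τ ∈ Set.Icc t₀ T, X t₀ = x₀ →
      (∀ t ∈ Set.Icc t₀ τ, HasDerivAt X (f t (X t)) t) → ‖X τ‖ ≤ R := by
  obtain ⟨c, hc, hcν⟩ := hν.exists_norm_le_mul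
  have hfx₀ : Continuous fun t => ν (f t x₀) :=
    hν.continuous.comp (hf.comp (continuous_id.prodMk continuous_const))
  obtain ⟨K, hK⟩ := (isCompact_Icc (a := t₀) (b := T)).exists_bound_of_continuousOn
    hfx₀.continuousOn
  have hgb : Continuous fun t => gronwallBound 0 b K (t - t₀) :=
    continuous_iff_continuousAt.2 fun t => (hasDerivAt_gronwallBound_shift 0 b K t t₀).continuousAt
  obtain ⟨B, hB⟩ := (isCompact_Icc (a := t₀) (b := T)).exists_bound_of_continuousOn
    hgb.continuousOn
  refine ⟨c * B + ‖x₀‖, fun X τ hτ hX0 hX => ?_⟩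
  have hXC := hCinv X t₀ τ ht₀ hτ.1 hX (hX0 ▸ hx₀)
  have hgron := hν.le_gronwallBound (Z := fun t => X t - x₀) (Z' := fun t => f t (X t)) (b := b)
    (ε := K) (fun t ht => (hX t ht).sub_const x₀) (fun t ht => by
      have h1 := h t (ht₀.trans ht.1) _ (hXC t ht) x₀ hx₀
      have h2 := hν.dirDeriv_add_le (X t - x₀) (f t (X t) - f t x₀) (f t x₀)
      rw [sub_add_cancel] at h2
      have h3 := (le_abs_self _).trans (hK t ⟨ht.1, ht.2.trans hτ.2⟩)
      linarith) τ ⟨hτ.1, le_rfl⟩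
  simp only [hX0, sub_self, hν.map_zero] at hgron
  have h1 := hgron.trans ((le_abs_self _).trans (hB τ hτ))
  calc ‖X τ‖ ≤ ‖X τ - x₀‖ + ‖x₀‖ := norm_le_norm_sub_add _ _
    _ ≤ c * B + ‖x₀‖ := by
      gcongr
      exact (hcν _).trans (mul_le_mul_of_nonneg_left h1 hc)

/-- Theorem 34 (contraction equivalences for continuous vector fields),
including uniqueness of solutions and global existence when `b < 0` and an
equilibrium exists. -/
theorem contraction_equivalences_continuous {n : ℕ}
    (f : ℝ → (Fin n → ℝ) → Fin n → ℝ)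
    (C : Set (Fin n → ℝ))
    (ν : (Fin n → ℝ) → ℝ) (P : (Fin n → ℝ) → (Fin n → ℝ) → ℝ) (b : ℝ)
    -- `f` is continuous in `(t,x)`
    (hf : Continuous fun p : ℝ × (Fin n → ℝ) => f p.1 p.2)
    -- `C` is open, connected, and forward invariant
    (hCopen : IsOpen C) (hCconn : IsConnected C)
    (hCinv : ∀ (x : ℝ → Fin n → ℝ) (t₀ T : ℝ), 0 ≤ t₀ → t₀ ≤ T →
      (∀ t ∈ Set.Icc t₀ T, HasDerivAt x (f t (x t)) t) → x t₀ ∈ C →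
      ∀ t ∈ Set.Icc t₀ T, x t ∈ C)
    -- `ν` is a norm with compatible weak pairing `P` satisfying the curve norm
    -- derivative formula and Deimling's inequality
    (hν : IsNorm ν) (hP : IsWeakPairing P) (hcomp : Compatible ν P)
    (hDei : DeimlingIneq ν P) (hCNDF : CurveNormDerivFormula ν P) :
    -- the three statements are equivalent
    ([(∀ t, 0 ≤ t → ∀ x ∈ C, ∀ y ∈ C,
        P (f t x - f t y) (x - y) ≤ b * ν (x - y) ^ 2),
      (∀ (X Y : ℝ → Fin n → ℝ) (t₀ T : ℝ), 0 ≤ t₀ → t₀ ≤ T →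
        (∀ t ∈ Set.Icc t₀ T, HasDerivAt X (f t (X t)) t) →
        (∀ t ∈ Set.Icc t₀ T, HasDerivAt Y (f t (Y t)) t) →
        X t₀ ∈ C → Y t₀ ∈ C →
        ∀ t ∈ Set.Icc t₀ T,
          DiniUpper (fun s => ν (X s - Y s)) t ≤ b * ν (X t - Y t)),
      (∀ (X Y : ℝ → Fin n → ℝ) (t₀ T : ℝ), 0 ≤ t₀ → t₀ ≤ T →
        (∀ t ∈ Set.Icc t₀ T, HasDerivAt X (f t (X t)) t) →
        (∀ t ∈ Set.Icc t₀ T, HasDerivAt Y (f t (Y t)) t) →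
        X t₀ ∈ C → Y t₀ ∈ C →
        ∀ s ∈ Set.Icc t₀ T, ∀ t ∈ Set.Icc s T,
          ν (X t - Y t) ≤ Real.exp (b * (t - s)) * ν (X s - Y s))].TFAE)
    ∧
    -- if they hold, solutions are unique
    ((∀ t, 0 ≤ t → ∀ x ∈ C, ∀ y ∈ C,
        P (f t x - f t y) (x - y) ≤ b * ν (x - y) ^ 2) →
      ∀ (X Y : ℝ → Fin n → ℝ) (t₀ T : ℝ), 0 ≤ t₀ → t₀ ≤ T →
        (∀ t ∈ Set.Icc t₀ T, HasDerivAt X (f t (X t)) t) →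
        (∀ t ∈ Set.Icc t₀ T, HasDerivAt Y (f t (Y t)) t) →
        X t₀ ∈ C → X t₀ = Y t₀ → ∀ t ∈ Set.Icc t₀ T, X t = Y t)
    ∧
    -- if moreover `b < 0` and an equilibrium exists, solutions exist uniquely
    -- for all time
    ((∀ t, 0 ≤ t → ∀ x ∈ C, ∀ y ∈ C,
        P (f t x - f t y) (x - y) ≤ b * ν (x - y) ^ 2) →
      b < 0 → ∀ xs : Fin n → ℝ, (∀ t, 0 ≤ t → f t xs = 0) →
      ∀ t₀, 0 ≤ t₀ → ∀ x₀ ∈ C, ∃ X : ℝ → Fin n → ℝ,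
        (X t₀ = x₀ ∧ ∀ t, t₀ ≤ t → HasDerivAt X (f t (X t)) t) ∧
        ∀ Y : ℝ → Fin n → ℝ,
          (Y t₀ = x₀ ∧ ∀ t, t₀ ≤ t → HasDerivAt Y (f t (Y t)) t) →
          ∀ t, t₀ ≤ t → Y t = X t) := by
  have hft : ∀ t, Continuous (f t) := fun t => hf.comp (continuous_const.prodMk continuous_id)
  have hdir : (∀ t, 0 ≤ t → ∀ x ∈ C, ∀ y ∈ C,
      P (f t x - f t y) (x - y) ≤ b * ν (x - y) ^ 2) →
      ∀ t, 0 ≤ t → ∀ x ∈ C, ∀ y ∈ C,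
        dirDeriv ν (x - y) (f t x - f t y) ≤ b * ν (x - y) := fun h t ht x hx y hy =>
    dirDeriv_le_of_pairing_le (hft t) hCopen hν hP hcomp hCNDF (h t ht) hx hy
  have htfae : [(∀ t, 0 ≤ t → ∀ x ∈ C, ∀ y ∈ C,
        P (f t x - f t y) (x - y) ≤ b * ν (x - y) ^ 2),
      (∀ (X Y : ℝ → Fin n → ℝ) (t₀ T : ℝ), 0 ≤ t₀ → t₀ ≤ T →
        (∀ t ∈ Set.Icc t₀ T, HasDerivAt X (f t (X t)) t) →
        (∀ t ∈ Set.Icc t₀ T, HasDerivAt Y (f t (Y t)) t) →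
        X t₀ ∈ C → Y t₀ ∈ C →
        ∀ t ∈ Set.Icc t₀ T,
          DiniUpper (fun s => ν (X s - Y s)) t ≤ b * ν (X t - Y t)),
      (∀ (X Y : ℝ → Fin n → ℝ) (t₀ T : ℝ), 0 ≤ t₀ → t₀ ≤ T →
        (∀ t ∈ Set.Icc t₀ T, HasDerivAt X (f t (X t)) t) →
        (∀ t ∈ Set.Icc t₀ T, HasDerivAt Y (f t (Y t)) t) →
        X t₀ ∈ C → Y t₀ ∈ C →
        ∀ s ∈ Set.Icc t₀ T, ∀ t ∈ Set.Icc s T,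
          ν (X t - Y t) ≤ Real.exp (b * (t - s)) * ν (X s - Y s))].TFAE := by
    tfae_have 1 → 2 := by
      intro h X Y t₀ T ht₀ hT hX hY hX0 hY0 t ht
      rw [hν.diniUpper_eq (Z := fun s => X s - Y s) ((hX t ht).sub (hY t ht))]
      exact hdir h t (ht₀.trans ht.1) _ (hCinv X t₀ T ht₀ hT hX hX0 t ht)
        _ (hCinv Y t₀ T ht₀ hT hY hY0 t ht)
    tfae_have 2 → 3 := by
      intro h X Y t₀ T ht₀ hT hX hY hX0 hY0 s hs t ht
      have hsub : Set.Icc s T ⊆ Set.Icc t₀ T := Set.Icc_subset_Icc_left hs.1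
      have hZ : ∀ r ∈ Set.Icc s T,
          HasDerivAt (fun s => X s - Y s) (f r (X r) - f r (Y r)) r :=
        fun r hr => (hX r (hsub hr)).sub (hY r (hsub hr))
      have hgron := hν.le_gronwallBound (b := b) (ε := 0) hZ (fun r hr => by
        rw [← hν.diniUpper_eq (hZ r hr), add_zero]
        exact h X Y t₀ T ht₀ hT hX hY hX0 hY0 r (hsub hr)) t ht
      rwa [gronwallBound_ε0, mul_comm] at hgron
    tfae_have 3 → 1 := by
      intro h t ht x hx y hy
      refine (hDei _ _ _ (hν.tendsto_dirDeriv _ _)).trans ?_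
      have := mul_le_mul_of_nonneg_left (dirDeriv_le_of_contraction hf hν h ht hx hy)
        (hν.nonneg (x - y))
      linarith
    tfae_finish
  have huniq : (∀ t, 0 ≤ t → ∀ x ∈ C, ∀ y ∈ C,
        P (f t x - f t y) (x - y) ≤ b * ν (x - y) ^ 2) →
      ∀ (X Y : ℝ → Fin n → ℝ) (t₀ T : ℝ), 0 ≤ t₀ → t₀ ≤ T →
        (∀ t ∈ Set.Icc t₀ T, HasDerivAt X (f t (X t)) t) →
        (∀ t ∈ Set.Icc t₀ T, HasDerivAt Y (f t (Y t)) t) →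
        X t₀ ∈ C → X t₀ = Y t₀ → ∀ t ∈ Set.Icc t₀ T, X t = Y t := by
    intro h X Y t₀ T ht₀ hT hX hY hX0 hXY t ht
    have h13 := htfae.out 0 2
    have h1 := h13.1 h X Y t₀ T ht₀ hT hX hY hX0 (hXY ▸ hX0) t₀ ⟨le_rfl, hT⟩ t ht
    rw [hXY, sub_self, hν.map_zero, mul_zero] at h1
    exact sub_eq_zero.1 (hν.eq_zero_of_le h1)
  refine ⟨htfae, huniq, fun h _ _ _ t₀ ht₀ x₀ hx₀ => ?_⟩
  obtain ⟨X, hX0, hX⟩ := exists_hasDerivAt_Ici_of_bound hf (t₀ := t₀) (x₀ := x₀)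
    (fun T _ => exists_norm_le_of_dirDeriv_le hf hν hCinv (hdir h) ht₀ hx₀ T)
    (fun X Y τ hτ hX0 hY0 hX hY => huniq h X Y t₀ τ ht₀ hτ hX hY (hX0 ▸ hx₀)
      (hX0.trans hY0.symm) τ ⟨hτ, le_rfl⟩)
  exact ⟨X, ⟨hX0, hX⟩, fun Y hY t ht => huniq h Y X t₀ t ht₀ ht (fun s hs => hY.2 s hs.1)
    (fun s hs => hX s hs.1) (hY.1 ▸ hx₀) (hY.1.trans hX0.symm) t ⟨ht, le_rfl⟩⟩
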